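/- For every α ∈ (1,2), the series defining g_α(x) converges absolutely for every x > 0, and for every real s with −1 < s < 1 − 1/α and s ≠ −1/α one has ∫₀^∞ x^s · g_α(x) dx = Γ(1+s)·sin(π/α) / (Γ(1+sα)·sin(π(s+1/α))); in particular (taking s = 0) ∫₀^∞ g_α(x) dx = 1. -/

import Mathlib

open Real MeasureTheory Set

/-- The density `g_α` of the first exit time above level 1 of a normalized
spectrally positive `α`-stable Lévy process:
`g_α(x) = Σ_{n≥1} x^{1/α−n−1}/(α Γ(αn−1) Γ(1+1/α−n))`. -/
noncomputable def exitDensity (α x : ℝ) : ℝ :=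
  ∑' n : ℕ, x ^ (1 / α - ((n : ℝ) + 1) - 1) /
    (α * Real.Gamma (α * ((n : ℝ) + 1) - 1) * Real.Gamma (1 + 1 / α - ((n : ℝ) + 1)))

theorem rpow_mul_Gamma_le_Gamma_add {x a : ℝ} (hx : 0 < x) (ha : 1 < a) :
    x ^ a * Real.Gamma x ≤ Real.Gamma (x + a) := by
  have ha0 : 0 < a := by linarith
  have h1 : 0 < 1 - 1 / a := by
    have : 1 / a < 1 := by rw [div_lt_one ha0]; exact ha
    linarith
  have hG := Real.Gamma_pos_of_pos hx
  have hG' := Real.Gamma_pos_of_pos (add_pos hx ha0)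
  have h := Real.Gamma_mul_add_mul_le_rpow_Gamma_mul_rpow_Gamma hx (add_pos hx ha0) h1
    (one_div_pos.2 ha0) (by ring)
  have e : (1 - 1 / a) * x + 1 / a * (x + a) = x + 1 := by field_simp; ring
  rw [e, Real.Gamma_add_one hx.ne'] at h
  have h2 := Real.rpow_le_rpow (by positivity) h ha0.le
  rw [Real.mul_rpow hx.le hG.le, Real.mul_rpow (by positivity) (by positivity),
    ← Real.rpow_mul hG.le, ← Real.rpow_mul hG'.le, one_div_mul_cancel ha0.ne', Real.rpow_one] at h2
  have e2 : (1 - 1 / a) * a = a - 1 := by field_simp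
  have e3 : Real.Gamma x ^ a = Real.Gamma x ^ (a - 1) * Real.Gamma x := by
    rw [← Real.rpow_add_one hG.ne']; congr 1; ring
  rw [e2, e3] at h2
  have h4 : 0 < Real.Gamma x ^ (a - 1) := Real.rpow_pos_of_pos hG _
  refine le_of_mul_le_mul_left ?_ h4
  linarith

theorem summable_pow_mul_Gamma_div_Gamma {α r : ℝ} (hα : 1 < α) (hr : 0 < r) :
    Summable fun m : ℕ => r ^ m * Real.Gamma ((m : ℝ) + 2 - 1 / α) /
      Real.Gamma (α * ((m : ℝ) + 1)) := by
  have hα0 : 0 < α := by linarith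
  have hb : 1 / α < 1 := by rw [div_lt_one hα0]; exact hα
  have hb0 : 0 < 1 / α := by positivity
  have ht : Filter.Tendsto (fun m : ℕ => 2 * r * ((m : ℝ) + 1) ^ (-(α - 1)))
      Filter.atTop (nhds (2 * r * 0)) := by
    refine Filter.Tendsto.const_mul _ ((tendsto_rpow_neg_atTop (by linarith)).comp ?_)
    exact Filter.tendsto_atTop_add_const_right _ _ tendsto_natCast_atTop_atTop
  rw [mul_zero] at ht
  refine summable_of_ratio_norm_eventually_le (r := 1 / 2) (by norm_num) ?_
  filter_upwards [ht.eventually_le_const (show (0 : ℝ) < 1 / 2 by norm_num)] with m hm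
  have hm0 : (0 : ℝ) ≤ m := m.cast_nonneg
  have hx : 0 < α * ((m : ℝ) + 1) := by positivity
  have g1 : 0 < Real.Gamma ((m : ℝ) + 2 - 1 / α) := Real.Gamma_pos_of_pos (by linarith)
  have g2 : 0 < Real.Gamma (α * ((m : ℝ) + 1)) := Real.Gamma_pos_of_pos hx
  have g3 := rpow_mul_Gamma_le_Gamma_add hx hα
  have e1 : α * (((m + 1 : ℕ) : ℝ) + 1) = α * ((m : ℝ) + 1) + α := by push_cast; ring
  have e2 : ((m + 1 : ℕ) : ℝ) + 2 - 1 / α = ((m : ℝ) + 2 - 1 / α) + 1 := by push_cast; ring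
  have g4 : 0 < (α * ((m : ℝ) + 1)) ^ α := Real.rpow_pos_of_pos hx _
  have g5 : 0 < Real.Gamma (α * ((m : ℝ) + 1) + α) := Real.Gamma_pos_of_pos (by linarith)
  rw [e1, e2, Real.Gamma_add_one (by linarith), Real.norm_of_nonneg, Real.norm_of_nonneg]
  rotate_left
  · positivity
  · have : 0 ≤ (m : ℝ) + 2 - 1 / α := by linarith
    positivity
  have h1 : ((m : ℝ) + 1) ^ α ≤ (α * ((m : ℝ) + 1)) ^ α :=
    Real.rpow_le_rpow (by positivity) (by nlinarith) hα0.le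
  have h2 : r * ((m : ℝ) + 2 - 1 / α) ≤ 1 / 2 * (α * ((m : ℝ) + 1)) ^ α := by
    have h3 : ((m : ℝ) + 1) ^ (-(α - 1)) * ((m : ℝ) + 1) ^ α = (m : ℝ) + 1 := by
      rw [← Real.rpow_add (by positivity)]; simp
    have h4 : 0 < ((m : ℝ) + 1) ^ α := Real.rpow_pos_of_pos (by positivity) _
    calc r * ((m : ℝ) + 2 - 1 / α) ≤ 2 * r * ((m : ℝ) + 1) := by nlinarith
      _ = (2 * r * ((m : ℝ) + 1) ^ (-(α - 1))) * ((m : ℝ) + 1) ^ α := by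
        rw [mul_assoc (2 * r) (((m : ℝ) + 1) ^ (-(α - 1))), h3]
      _ ≤ 1 / 2 * ((m : ℝ) + 1) ^ α := by gcongr
      _ ≤ _ := by gcongr
  calc r ^ (m + 1) * (((m : ℝ) + 2 - 1 / α) * Real.Gamma ((m : ℝ) + 2 - 1 / α)) /
        Real.Gamma (α * ((m : ℝ) + 1) + α)
      = (r * ((m : ℝ) + 2 - 1 / α)) * (r ^ m * Real.Gamma ((m : ℝ) + 2 - 1 / α)) /
        Real.Gamma (α * ((m : ℝ) + 1) + α) := by ring
    _ ≤ (1 / 2 * (α * ((m : ℝ) + 1)) ^ α) * (r ^ m * Real.Gamma ((m : ℝ) + 2 - 1 / α)) /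
        ((α * ((m : ℝ) + 1)) ^ α * Real.Gamma (α * ((m : ℝ) + 1))) := by gcongr
    _ = _ := by field_simp

theorem summable_pow_div_Gamma {α r : ℝ} (hα : 1 < α) (hr : 0 < r) :
    Summable fun m : ℕ => r ^ m / Real.Gamma (α * ((m : ℝ) + 1)) := by
  have hα0 : 0 < α := by linarith
  have hb : 1 / α < 1 := by rw [div_lt_one hα0]; exact hα
  rw [← summable_nat_add_iff 1]
  refine ((summable_nat_add_iff 1).2 (summable_pow_mul_Gamma_div_Gamma hα hr)).of_nonneg_of_le
    (fun m => ?_) fun m => ?_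
  · have := Real.Gamma_pos_of_pos (show 0 < α * (((m + 1 : ℕ) : ℝ) + 1) by positivity)
    positivity
  · have h0 := Real.Gamma_pos_of_pos (show 0 < α * (((m + 1 : ℕ) : ℝ) + 1) by positivity)
    have h2 : (2 : ℝ) ≤ ((m + 1 : ℕ) : ℝ) + 2 - 1 / α := by
      push_cast; have : (0 : ℝ) ≤ m := m.cast_nonneg
      linarith
    have h1 : 1 ≤ Real.Gamma (((m + 1 : ℕ) : ℝ) + 2 - 1 / α) := by
      have := Real.Gamma_strictMonoOn_Ici.monotoneOn (mem_Ici.2 le_rfl) h2 h2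
      rwa [Real.Gamma_two] at this
    gcongr
    exact le_mul_of_one_le_right (by positivity) h1

/-- The Mittag-Leffler function `t ↦ E_{α,α}(-t)`. -/
noncomputable def mittagLefflerNeg (α t : ℝ) : ℝ :=
  ∑' m : ℕ, (-t) ^ m / Real.Gamma (α * ((m : ℝ) + 1))

theorem norm_mittagLefflerNeg_term_le {α t R : ℝ} (hα : 1 < α) (ht : |t| ≤ R) (m : ℕ) :
    ‖(-t) ^ m / Real.Gamma (α * ((m : ℝ) + 1))‖ ≤ R ^ m / Real.Gamma (α * ((m : ℝ) + 1)) := by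
  have h0 := Real.Gamma_pos_of_pos (show 0 < α * ((m : ℝ) + 1) by positivity)
  rw [norm_div, norm_pow, norm_neg, Real.norm_of_nonneg h0.le, Real.norm_eq_abs]
  gcongr

theorem continuous_mittagLefflerNeg {α : ℝ} (hα : 1 < α) : Continuous (mittagLefflerNeg α) := by
  rw [continuous_iff_continuousAt]
  intro t
  have hR : 0 < |t| + 1 := by positivity
  have h : ContinuousOn (mittagLefflerNeg α) (Metric.ball 0 (|t| + 1)) := by
    refine continuousOn_tsum (fun m => ?_) (summable_pow_div_Gamma hα hR) fun m x hx => ?_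
    · fun_prop
    · exact norm_mittagLefflerNeg_term_le hα (by simpa using (mem_ball_zero_iff.1 hx).le) m
  exact h.continuousAt (Metric.isOpen_ball.mem_nhds (by simp))

/-- `u ^ 2` times the inverse Laplace transform of `1 / (1 + λ ^ α)`. -/
noncomputable def resolventKernel (α u : ℝ) : ℝ := u ^ (α + 1) * mittagLefflerNeg α (u ^ α)

theorem continuous_resolventKernel {α : ℝ} (hα : 1 < α) : Continuous (resolventKernel α) :=
  (Real.continuous_rpow_const (by linarith)).mul
    ((continuous_mittagLefflerNeg hα).comp (Real.continuous_rpow_const (by linarith)))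

theorem resolventKernel_zero {α : ℝ} (hα : 1 < α) : resolventKernel α 0 = 0 := by
  rw [resolventKernel, Real.zero_rpow (by linarith), zero_mul]

theorem exists_abs_resolventKernel_le {α : ℝ} (hα : 1 < α) :
    ∃ C, ∀ u ∈ Ioc (0 : ℝ) 1, |resolventKernel α u| ≤ C * u ^ (α + 1) := by
  obtain ⟨C, hC⟩ := (isCompact_Icc (a := (0 : ℝ)) (b := 1)).exists_bound_of_continuousOn
    (continuous_mittagLefflerNeg hα).continuousOn
  refine ⟨C, fun u hu => ?_⟩
  have hp : 0 < u ^ (α + 1) := Real.rpow_pos_of_pos hu.1 _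
  rw [resolventKernel, abs_mul, abs_of_pos hp, mul_comm]
  gcongr
  exact hC _ ⟨(Real.rpow_pos_of_pos hu.1 _).le, Real.rpow_le_one hu.1.le hu.2 (by linarith)⟩

theorem resolventKernel_eq_tsum {α u : ℝ} (hu : 0 < u) :
    resolventKernel α u = ∑' m : ℕ, (-1) ^ m * u ^ (α * ((m : ℝ) + 1) + 1) /
      Real.Gamma (α * ((m : ℝ) + 1)) := by
  rw [resolventKernel, mittagLefflerNeg, ← tsum_mul_left]
  refine tsum_congr fun m => ?_
  have : u ^ (α * ((m : ℝ) + 1) + 1) = u ^ (α + 1) * (u ^ α) ^ m := by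
    rw [← Real.rpow_mul_natCast hu.le, ← Real.rpow_add hu]; congr 1; ring
  rw [this, neg_pow]; ring

theorem integrableOn_rpow_mul_exp_neg_mul {a r : ℝ} (ha : 0 < a) (hr : 0 < r) :
    IntegrableOn (fun t : ℝ => t ^ (a - 1) * rexp (-(r * t))) (Ioi 0) := by
  simpa [neg_mul] using integrableOn_rpow_mul_exp_neg_mul_rpow (p := 1) (s := a - 1)
    (by linarith) one_pos hr

theorem integral_rpow_mul_cexp_neg_mul {a : ℝ} {z : ℂ} (ha : 0 < a) (hz : 0 < z.re) :
    ∫ t in Ioi (0 : ℝ), ((t ^ (a - 1) : ℝ) : ℂ) * Complex.exp (-(z * t)) =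
      z ^ (-(a : ℂ)) * (Real.Gamma a : ℝ) := by
  have hmeas : Measurable fun t : ℝ => (t ^ (a - 1)).toNNReal := by fun_prop
  have hcoe : ∀ t ∈ Ioi (0 : ℝ), (((t ^ (a - 1)).toNNReal : NNReal) : ℝ) = t ^ (a - 1) :=
    fun t ht => Real.coe_toNNReal _ (Real.rpow_pos_of_pos ht _).le
  let μ : Measure ℝ := (volume.restrict (Ioi (0 : ℝ))).withDensity
    fun t => ((t ^ (a - 1)).toNNReal : NNReal)
  have hset : Iio (0 : ℝ) ⊆ interior (ProbabilityTheory.integrableExpSet id μ) := by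
    refine interior_maximal (fun r hr => ?_) isOpen_Iio
    change Integrable (fun t => rexp (r * id t)) μ
    rw [integrable_withDensity_iff_integrable_coe_smul hmeas]
    refine (integrableOn_rpow_mul_exp_neg_mul ha (neg_pos.2 hr)).congr_fun (fun t ht => ?_)
      measurableSet_Ioi
    simp [hcoe t ht]
  have hmgf : ∀ w : ℂ, ProbabilityTheory.complexMGF id μ (-w) =
      ∫ t in Ioi (0 : ℝ), ((t ^ (a - 1) : ℝ) : ℂ) * Complex.exp (-(w * t)) := by
    intro w
    rw [ProbabilityTheory.complexMGF, integral_withDensity_eq_integral_smul hmeas]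
    refine setIntegral_congr_fun measurableSet_Ioi fun t ht => ?_
    simp only [NNReal.smul_def, hcoe t ht, id, Complex.real_smul, neg_mul]
  have hU : IsPreconnected {w : ℂ | 0 < w.re} := (convex_halfSpace_re_gt 0).isPreconnected
  have hUo : IsOpen {w : ℂ | 0 < w.re} := isOpen_lt continuous_const Complex.continuous_re
  have hf : AnalyticOnNhd ℂ (fun w => ProbabilityTheory.complexMGF id μ (-w))
      {w : ℂ | 0 < w.re} := by
    intro w hw
    refine AnalyticAt.fun_comp ?_ analyticAt_id.neg
    refine ProbabilityTheory.analyticAt_complexMGF (hset ?_)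
    simpa using hw
  have hg : AnalyticOnNhd ℂ (fun w : ℂ => w ^ (-(a : ℂ)) * (Real.Gamma a : ℝ))
      {w : ℂ | 0 < w.re} := by
    intro w hw
    exact (analyticAt_id.cpow analyticAt_const (Or.inl hw)).mul analyticAt_const
  have hfreq : ∃ᶠ w in nhdsWithin (1 : ℂ) {1}ᶜ,
      ProbabilityTheory.complexMGF id μ (-w) = w ^ (-(a : ℂ)) * (Real.Gamma a : ℝ) := by
    have ht : Filter.Tendsto (fun r : ℝ => (r : ℂ)) (nhdsWithin 1 {1}ᶜ)
        (nhdsWithin (1 : ℂ) {1}ᶜ) := by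
      refine tendsto_nhdsWithin_iff.2 ⟨?_, ?_⟩
      · exact (Complex.continuous_ofReal.tendsto' 1 1 (by simp)).mono_left nhdsWithin_le_nhds
      · filter_upwards [self_mem_nhdsWithin] with r hr
        simpa using hr
    refine ht.frequently (Filter.Eventually.frequently ?_)
    filter_upwards [nhdsWithin_le_nhds (lt_mem_nhds (zero_lt_one' ℝ))] with r hr
    rw [hmgf, ← Complex.ofReal_neg, ← Complex.ofReal_cpow hr.le, ← Complex.ofReal_mul]
    have := Real.integral_rpow_mul_exp_neg_mul_Ioi ha hr
    rw [one_div, Real.inv_rpow hr.le, ← Real.rpow_neg hr.le] at this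
    rw [← this, ← integral_complex_ofReal]
    simp
  have := hf.eqOn_of_preconnected_of_frequently_eq hg hU (by simp) hfreq hz
  rw [← hmgf]
  exact this

theorem hasSum_quadratic_mul_geometric {K : Type*} [RCLike K] (a : K) {r : K} (hr : ‖r‖ < 1) :
    HasSum (fun m : ℕ => (a * ((m : K) + 1) + 1) * (a * ((m : K) + 1)) * r ^ m)
      (a * (2 * a + (1 - a) * (1 - r)) / (1 - r) ^ 3) := by
  have h1 := (hasSum_choose_mul_geometric_of_norm_lt_one 2 hr).mul_left (2 * a ^ 2)
  have h2 := (hasSum_choose_mul_geometric_of_norm_lt_one 1 hr).mul_left (a * (1 - a))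
  have hr1 : 1 - r ≠ 0 := by
    intro h
    rw [← sub_eq_zero.1 h] at hr
    simp at hr
  have h := h1.add h2
  convert! h using 1
  · funext m
    have hc : (((m + 2).choose 2 : ℕ) : K) = ((m : K) + 2) * ((m : K) + 1) / 2 := by
      rw [Nat.cast_choose_two]; push_cast; ring
    rw [hc, Nat.choose_one_right]
    push_cast
    ring
  · field_simp
    ring

/-- The second derivative of `z ↦ 1 / (1 + z ^ α)`, i.e. the Laplace transform of
`resolventKernel α`. -/
noncomputable def resolventSymbol (α : ℝ) (z : ℂ) : ℂ :=
  α * z ^ ((α : ℂ) - 2) * ((α + 1) * z ^ (α : ℂ) - (α - 1)) / (1 + z ^ (α : ℂ)) ^ 3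

theorem Gamma_add_two_div_Gamma {x : ℝ} (hx : 0 < x) :
    Real.Gamma (x + 2) / Real.Gamma x = (x + 1) * x := by
  have h : x + 2 = (x + 1) + 1 := by ring
  have := (Real.Gamma_pos_of_pos hx).ne'
  rw [h, Real.Gamma_add_one (by linarith), Real.Gamma_add_one hx.ne']
  field_simp

theorem integral_cexp_mul_resolventKernel_of_one_lt_re {α : ℝ} (hα : 1 < α) {z : ℂ}
    (hz : 1 < z.re) :
    ∫ u in Ioi (0 : ℝ), Complex.exp (-(z * u)) * (resolventKernel α u : ℝ) =
      resolventSymbol α z := by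
  have hα0 : 0 < α := by linarith
  have hz0 : 0 < z.re := by linarith
  have hzne : z ≠ 0 := by rintro rfl; simp at hz0
  let F : ℕ → ℝ → ℂ := fun m u => (((-1) ^ m / Real.Gamma (α * ((m : ℝ) + 1)) : ℝ) : ℂ) *
    (((u ^ (α * ((m : ℝ) + 1) + 2 - 1) : ℝ) : ℂ) * Complex.exp (-(z * u)))
  have ha : ∀ m : ℕ, 0 < α * ((m : ℝ) + 1) := fun m => by positivity
  have ha2 : ∀ m : ℕ, 0 < α * ((m : ℝ) + 1) + 2 := fun m => by linarith [ha m]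
  have hnorm : ∀ m : ℕ, ∀ u ∈ Ioi (0 : ℝ), ‖F m u‖ = 1 / Real.Gamma (α * ((m : ℝ) + 1)) *
      (u ^ (α * ((m : ℝ) + 1) + 2 - 1) * rexp (-(z.re * u))) := by
    intro m u hu
    have := Real.Gamma_pos_of_pos (ha m)
    have h2 := Real.rpow_pos_of_pos hu (α * ((m : ℝ) + 1) + 2 - 1)
    simp only [F, norm_mul, Complex.norm_exp, Complex.norm_real, norm_div, norm_pow, norm_neg,
      norm_one, one_pow, Real.norm_of_nonneg this.le, Real.norm_of_nonneg h2.le]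
    simp
  have hintg : ∀ m, IntegrableOn (F m) (Ioi 0) := by
    intro m
    have h := (integrableOn_rpow_mul_exp_neg_mul (ha2 m) hz0).const_mul
      (1 / Real.Gamma (α * ((m : ℝ) + 1)))
    refine Integrable.mono' h ?_ ?_
    · exact (by fun_prop : Measurable (F m)).aestronglyMeasurable
    · filter_upwards [ae_restrict_mem measurableSet_Ioi] with u hu
      exact (hnorm m u hu).le
  have hval : ∀ m, ∫ u in Ioi (0 : ℝ), F m u = z ^ (-(α : ℂ) - 2) *
      (((α : ℂ) * ((m : ℂ) + 1) + 1) * ((α : ℂ) * ((m : ℂ) + 1)) * (-z ^ (-(α : ℂ))) ^ m) := by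
    intro m
    rw [integral_const_mul, integral_rpow_mul_cexp_neg_mul (ha2 m) hz0]
    have h1 : z ^ (-((α * ((m : ℝ) + 1) + 2 : ℝ) : ℂ)) =
        z ^ (-(α : ℂ) - 2) * (z ^ (-(α : ℂ))) ^ m := by
      rw [← Complex.cpow_mul_nat, ← Complex.cpow_add _ _ hzne]
      congr 1; push_cast; ring
    have h2 : (((-1) ^ m / Real.Gamma (α * ((m : ℝ) + 1)) : ℝ) : ℂ) *
        (Real.Gamma (α * ((m : ℝ) + 1) + 2) : ℝ) =
        (-1) ^ m * (((α : ℂ) * ((m : ℂ) + 1) + 1) * ((α : ℂ) * ((m : ℂ) + 1))) := by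
      rw [← Complex.ofReal_mul, div_mul_eq_mul_div, mul_div_assoc, Gamma_add_two_div_Gamma (ha m)]
      push_cast; ring
    rw [h1, neg_pow (z ^ (-(α : ℂ)))]
    linear_combination (z ^ (-(α : ℂ) - 2) * (z ^ (-(α : ℂ))) ^ m) * h2
  have hq : ‖-z ^ (-(α : ℂ))‖ < 1 := by
    rw [norm_neg, ← Complex.ofReal_neg, Complex.norm_cpow_real]
    exact Real.rpow_lt_one_of_one_lt_of_neg (hz.trans_le (Complex.re_le_norm z)) (by linarith)
  have hsum : Summable fun m => ∫ u in Ioi (0 : ℝ), ‖F m u‖ := by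
    have hr : ‖z.re ^ (-α)‖ < 1 := by
      rw [Real.norm_of_nonneg (Real.rpow_pos_of_pos hz0 _).le]
      exact Real.rpow_lt_one_of_one_lt_of_neg hz (by linarith)
    refine ((hasSum_quadratic_mul_geometric α hr).summable.mul_left (z.re ^ (-α - 2))).congr
      fun m => ?_
    rw [setIntegral_congr_fun measurableSet_Ioi (hnorm m), integral_const_mul,
      Real.integral_rpow_mul_exp_neg_mul_Ioi (ha2 m) hz0, ← Gamma_add_two_div_Gamma (ha m),
      one_div z.re, Real.inv_rpow hz0.le, ← Real.rpow_neg hz0.le, ← Real.rpow_mul_natCast hz0.le]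
    have : z.re ^ (-(α * ((m : ℝ) + 1) + 2)) = z.re ^ (-α - 2) * z.re ^ (-α * (m : ℝ)) := by
      rw [← Real.rpow_add hz0]; congr 1; ring
    rw [this]; ring
  have h := hasSum_integral_of_summable_integral_norm hintg hsum
  simp only [hval] at h
  have h' := h.unique ((hasSum_quadratic_mul_geometric (α : ℂ) hq).mul_left _)
  have hlhs : ∫ u in Ioi (0 : ℝ), Complex.exp (-(z * u)) * (resolventKernel α u : ℝ) =
      ∫ u in Ioi (0 : ℝ), ∑' m, F m u := by
    refine setIntegral_congr_fun measurableSet_Ioi fun u hu => ?_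
    simp only [F]
    rw [resolventKernel_eq_tsum hu, Complex.ofReal_tsum, ← tsum_mul_left]
    refine tsum_congr fun m => ?_
    have : α * ((m : ℝ) + 1) + 2 - 1 = α * ((m : ℝ) + 1) + 1 := by ring
    rw [this]
    push_cast
    ring
  rw [hlhs, h', resolventSymbol]
  have hw : z ^ (α : ℂ) ≠ 0 := by simp [Complex.cpow_eq_zero_iff, hzne]
  have hi : z ^ (-(α : ℂ)) = (z ^ (α : ℂ))⁻¹ := Complex.cpow_neg _ _
  have h3 : z ^ (-(α : ℂ) - 2) = (z ^ (α : ℂ))⁻¹ * (z ^ (2 : ℂ))⁻¹ := by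
    rw [sub_eq_add_neg, Complex.cpow_add _ _ hzne, hi, Complex.cpow_neg]
  have h4 : z ^ ((α : ℂ) - 2) = z ^ (α : ℂ) * (z ^ (2 : ℂ))⁻¹ := by
    rw [sub_eq_add_neg, Complex.cpow_add _ _ hzne, Complex.cpow_neg]
  have h5 : 1 + z ^ (α : ℂ) ≠ 0 := by
    intro h
    rw [hi, eq_neg_of_add_eq_zero_right h] at hq
    norm_num at hq
  rw [h3, h4, hi]
  have h6 : 1 - -(z ^ (α : ℂ))⁻¹ = (1 + z ^ (α : ℂ)) * (z ^ (α : ℂ))⁻¹ := by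
    field_simp; ring
  rw [h6]
  generalize z ^ (α : ℂ) = w at *
  field_simp
  ring

theorem exists_le_norm_one_add_cpow {α : ℝ} (hα : α ∈ Ioo (1 : ℝ) 2) :
    ∃ δ > 0, ∀ z : ℂ, 0 < z.re → δ * (1 + ‖z‖ ^ α) ≤ ‖1 + z ^ (α : ℂ)‖ := by
  obtain ⟨h1, h2⟩ := hα
  have hπ := Real.pi_pos
  have hc : 0 < 1 + Real.cos (π / 2 * α) := by
    have : Real.cos π < Real.cos (π / 2 * α) :=
      Real.cos_lt_cos_of_nonneg_of_le_pi (by positivity) le_rfl (by nlinarith)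
    rw [Real.cos_pi] at this
    linarith
  refine ⟨√((1 + Real.cos (π / 2 * α)) / 2), by positivity, fun z hz => ?_⟩
  have harg : |z.arg| < π / 2 := Complex.abs_arg_lt_pi_div_two_iff.2 (Or.inl hz)
  have hcos : Real.cos (π / 2 * α) ≤ Real.cos (z.arg * α) := by
    rw [← Real.cos_abs (z.arg * α), abs_mul, abs_of_pos (show 0 < α by linarith)]
    exact Real.cos_le_cos_of_nonneg_of_le_pi (by positivity) (by nlinarith) (by gcongr)
  have hre : (z ^ (α : ℂ)).re = ‖z‖ ^ α * Real.cos (z.arg * α) := Complex.cpow_ofReal_re _ _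
  have hn : ‖z ^ (α : ℂ)‖ = ‖z‖ ^ α := Complex.norm_cpow_real _ _
  have hs : ‖1 + z ^ (α : ℂ)‖ ^ 2 = 1 + 2 * (‖z‖ ^ α * Real.cos (z.arg * α)) + (‖z‖ ^ α) ^ 2 := by
    rw [← hre, ← hn, ← Complex.normSq_eq_norm_sq, ← Complex.normSq_eq_norm_sq,
      Complex.normSq_apply, Complex.normSq_apply]
    simp
    ring
  have hp : 0 ≤ ‖z‖ ^ α := by positivity
  refine le_of_sq_le_sq ?_ (norm_nonneg _)
  rw [mul_pow, Real.sq_sqrt (by positivity), hs]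
  nlinarith [mul_nonneg (sub_nonneg.2 (Real.cos_le_one (π / 2 * α))) (sq_nonneg (1 - ‖z‖ ^ α)),
    mul_le_mul_of_nonneg_left hcos hp]

/-- An integrable majorant of `resolventSymbol α` on vertical lines in the right half plane. -/
noncomputable def symbolMajorant (α y : ℝ) : ℝ := |y| ^ (α - 2) / (1 + |y| ^ α) ^ 2

theorem symbolMajorant_nonneg (α y : ℝ) : 0 ≤ symbolMajorant α y := by
  unfold symbolMajorant; positivity

theorem symbolMajorant_le {α y : ℝ} (hy : 1 ≤ y) :
    symbolMajorant α y ≤ y ^ (-2 : ℝ) := by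
  have hy0 : 0 < y := by linarith
  have h := Real.rpow_pos_of_pos hy0 α
  rw [symbolMajorant, abs_of_pos hy0, div_le_iff₀ (by positivity),
    show α - 2 = -2 + α by ring, Real.rpow_add hy0]
  have : 0 < y ^ (-2 : ℝ) := Real.rpow_pos_of_pos hy0 _
  gcongr
  nlinarith

theorem integrable_symbolMajorant {α : ℝ} (hα : 1 < α) : Integrable (symbolMajorant α) := by
  have hm : Measurable (symbolMajorant α) := by unfold symbolMajorant; fun_prop
  have key : IntegrableOn (symbolMajorant α) (Ioi 0) := by
    rw [← Ioc_union_Ioi_eq_Ioi zero_le_one]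
    refine IntegrableOn.union ?_ ?_
    · have h : IntegrableOn (fun y : ℝ => y ^ (α - 2)) (Ioc 0 1) :=
        (intervalIntegrable_iff_integrableOn_Ioc_of_le zero_le_one).1
          (intervalIntegral.intervalIntegrable_rpow' (by linarith))
      refine Integrable.mono' h hm.aestronglyMeasurable ?_
      filter_upwards [ae_restrict_mem measurableSet_Ioc] with y hy
      rw [Real.norm_of_nonneg (symbolMajorant_nonneg α y), symbolMajorant, abs_of_pos hy.1]
      have := Real.rpow_pos_of_pos hy.1 α
      have := Real.rpow_pos_of_pos hy.1 (α - 2)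
      exact div_le_self (by positivity) (by nlinarith)
    · refine Integrable.mono' (integrableOn_Ioi_rpow_of_lt (by norm_num : (-2 : ℝ) < -1) one_pos)
        hm.aestronglyMeasurable ?_
      filter_upwards [ae_restrict_mem measurableSet_Ioi] with y hy
      rw [Real.norm_of_nonneg (symbolMajorant_nonneg α y)]
      exact symbolMajorant_le (le_of_lt hy)
  have hneg : IntegrableOn (symbolMajorant α) (Iic 0) := by
    rw [← Measure.map_neg_eq_self (volume : Measure ℝ)]
    let m : MeasurableEmbedding fun x : ℝ => -x := (Homeomorph.neg ℝ).measurableEmbedding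
    rw [m.integrableOn_map_iff]
    simp_rw [Function.comp_def, symbolMajorant, abs_neg, neg_preimage, neg_Iic, neg_zero]
    exact Iff.mpr integrableOn_Ici_iff_integrableOn_Ioi key
  rw [← integrableOn_univ, ← Iic_union_Ioi (a := (0 : ℝ))]
  exact hneg.union key

theorem exists_norm_resolventSymbol_le {α : ℝ} (hα : α ∈ Ioo (1 : ℝ) 2) :
    ∃ K, 0 ≤ K ∧ ∀ z : ℂ, 0 < z.re → z.im ≠ 0 →
      ‖resolventSymbol α z‖ ≤ K * symbolMajorant α z.im := by
  obtain ⟨δ, hδ, h⟩ := exists_le_norm_one_add_cpow hα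
  obtain ⟨h1, h2⟩ := hα
  have hα0 : 0 < α := by linarith
  refine ⟨α * (α + 1) / δ ^ 3, by positivity, fun z hz hy => ?_⟩
  have hzi : 0 < |z.im| := abs_pos.2 hy
  have hle : |z.im| ≤ ‖z‖ := Complex.abs_im_le_norm z
  have hz0 : 0 < ‖z‖ := hzi.trans_le hle
  have hN : ‖(α + 1) * z ^ (α : ℂ) - (α - 1)‖ ≤ (α + 1) * (1 + ‖z‖ ^ α) := by
    refine (norm_sub_le _ _).trans ?_
    rw [norm_mul, Complex.norm_cpow_real]
    have e1 : ‖(α : ℂ) + 1‖ = α + 1 := by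
      rw [← Complex.ofReal_one, ← Complex.ofReal_add, Complex.norm_real,
        Real.norm_of_nonneg (by linarith)]
    have e2 : ‖(α : ℂ) - 1‖ = α - 1 := by
      rw [← Complex.ofReal_one, ← Complex.ofReal_sub, Complex.norm_real,
        Real.norm_of_nonneg (by linarith)]
    rw [e1, e2]
    nlinarith
  have e3 : ‖z ^ ((α : ℂ) - 2)‖ = ‖z‖ ^ (α - 2) := by
    rw [← Complex.norm_cpow_real]; push_cast; rfl
  have hp : 0 < ‖z‖ ^ α := Real.rpow_pos_of_pos hz0 _
  have hq : 0 < ‖z‖ ^ (α - 2) := Real.rpow_pos_of_pos hz0 _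
  have hD : 0 < ‖1 + z ^ (α : ℂ)‖ := lt_of_lt_of_le (by positivity) (h z hz)
  rw [resolventSymbol, norm_div, norm_mul, norm_mul, norm_pow, e3, Complex.norm_real,
    Real.norm_of_nonneg hα0.le]
  calc α * ‖z‖ ^ (α - 2) * ‖(α + 1) * z ^ (α : ℂ) - (α - 1)‖ / ‖1 + z ^ (α : ℂ)‖ ^ 3
      ≤ α * ‖z‖ ^ (α - 2) * ((α + 1) * (1 + ‖z‖ ^ α)) / (δ * (1 + ‖z‖ ^ α)) ^ 3 := by
        gcongr
        exact h z hz
    _ = α * (α + 1) / δ ^ 3 * (‖z‖ ^ (α - 2) / (1 + ‖z‖ ^ α) ^ 2) := by field_simp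
    _ ≤ α * (α + 1) / δ ^ 3 * (|z.im| ^ (α - 2) / (1 + |z.im| ^ α) ^ 2) := by
        gcongr ?_ * (?_ / (1 + ?_) ^ 2)
        · exact Real.rpow_le_rpow_of_nonpos hzi hle (by linarith)
        · gcongr

theorem one_add_cpow_ne_zero {α : ℝ} (hα : α ∈ Ioo (1 : ℝ) 2) {z : ℂ} (hz : 0 < z.re) :
    1 + z ^ (α : ℂ) ≠ 0 := by
  obtain ⟨δ, hδ, h⟩ := exists_le_norm_one_add_cpow hα
  exact norm_pos_iff.1 (lt_of_lt_of_le (by positivity) (h z hz))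

theorem differentiableOn_resolventSymbol {α : ℝ} (hα : α ∈ Ioo (1 : ℝ) 2) :
    DifferentiableOn ℂ (resolventSymbol α) {z : ℂ | 0 < z.re} := by
  intro z hz
  have hs : z ∈ Complex.slitPlane := Or.inl hz
  have h1 : ∀ c : ℂ, DifferentiableAt ℂ (fun z : ℂ => z ^ c) z := fun c =>
    differentiableAt_id.cpow_const hs
  have h0 := one_add_cpow_ne_zero hα hz
  refine DifferentiableAt.differentiableWithinAt ?_
  unfold resolventSymbol
  refine DifferentiableAt.div ?_ ?_ (pow_ne_zero _ h0)
  · exact ((h1 _).const_mul _).mul (((h1 _).const_mul _).sub_const _)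
  · exact ((h1 _).const_add _).pow 3

theorem continuous_resolventSymbol_vertical {α : ℝ} (hα : α ∈ Ioo (1 : ℝ) 2) {c : ℝ}
    (hc : 0 < c) : Continuous fun y : ℝ => resolventSymbol α (c + y * Complex.I) :=
  (differentiableOn_resolventSymbol hα).continuousOn.comp_continuous (by fun_prop)
    fun y => by simpa using hc

theorem integrable_resolventSymbol_vertical {α : ℝ} (hα : α ∈ Ioo (1 : ℝ) 2) {c : ℝ}
    (hc : 0 < c) : Integrable fun y : ℝ => resolventSymbol α (c + y * Complex.I) := by
  obtain ⟨K, -, hK⟩ := exists_norm_resolventSymbol_le hα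
  refine Integrable.mono' ((integrable_symbolMajorant hα.1).const_mul K)
    (continuous_resolventSymbol_vertical hα hc).aestronglyMeasurable ?_
  filter_upwards [compl_mem_ae_iff.2 (measure_singleton (0 : ℝ))] with y hy
  simpa using hK (c + y * Complex.I) (by simpa using hc) (by simpa using hy)

theorem norm_cexp_mul_ofReal (c y u : ℝ) :
    ‖Complex.exp ((c + y * Complex.I) * u)‖ = rexp (c * u) := by
  rw [Complex.norm_exp]; simp

theorem integrable_cexp_mul_resolventSymbol {α : ℝ} (hα : α ∈ Ioo (1 : ℝ) 2) {c : ℝ}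
    (hc : 0 < c) (u : ℝ) : Integrable fun y : ℝ =>
      Complex.exp ((c + y * Complex.I) * u) * resolventSymbol α (c + y * Complex.I) := by
  refine (integrable_resolventSymbol_vertical hα hc).bdd_mul (c := rexp (c * u)) ?_ ?_
  · exact (by fun_prop : Continuous fun y : ℝ =>
      Complex.exp ((c + y * Complex.I) * u)).aestronglyMeasurable
  · exact Filter.Eventually.of_forall fun y => (norm_cexp_mul_ofReal c y u).le

theorem tendsto_integral_horizontal_resolventSymbol {α : ℝ} (hα : α ∈ Ioo (1 : ℝ) 2) {c d : ℝ}
    (hc : 0 < c) (hd : 0 < d) (u : ℝ) {s : ℝ → ℝ} (hs : ∀ T, |s T| = |T|) :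
    Filter.Tendsto (fun T : ℝ => ∫ x in c..d, Complex.exp ((x + s T * Complex.I) * u) *
      resolventSymbol α (x + s T * Complex.I)) Filter.atTop (nhds 0) := by
  obtain ⟨K, hK0, hK⟩ := exists_norm_resolventSymbol_le hα
  have hlim : Filter.Tendsto (fun T : ℝ => rexp (max c d * |u|) * (K * T ^ (-2 : ℝ)) * |d - c|)
      Filter.atTop (nhds (rexp (max c d * |u|) * (K * 0) * |d - c|)) :=
    (((tendsto_rpow_neg_atTop (by norm_num : (0 : ℝ) < 2)).const_mul K).const_mul _).mul_const _
  rw [mul_zero, mul_zero, zero_mul] at hlim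
  refine squeeze_zero_norm' ?_ hlim
  filter_upwards [Filter.eventually_ge_atTop 1] with T hT
  refine intervalIntegral.norm_integral_le_of_norm_le_const fun x hx => ?_
  rw [uIoc, mem_Ioc] at hx
  have hx0 : 0 < x := (lt_min hc hd).trans hx.1
  have hsT : |s T| = T := by rw [hs, abs_of_pos (by linarith)]
  have hs0 : s T ≠ 0 := by
    intro h; rw [h, abs_zero] at hsT; linarith
  rw [norm_mul, norm_cexp_mul_ofReal]
  refine mul_le_mul (Real.exp_le_exp.2 ?_) ?_ (norm_nonneg _) (Real.exp_pos _).le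
  · calc x * u ≤ x * |u| := by gcongr; exact le_abs_self u
      _ ≤ max c d * |u| := by gcongr; exact hx.2
  · refine (hK (x + s T * Complex.I) (by simpa using hx0) (by simpa using hs0)).trans ?_
    gcongr
    have : symbolMajorant α (s T) = symbolMajorant α T := by
      rw [symbolMajorant, symbolMajorant, hs]
    simpa [this] using symbolMajorant_le (α := α) hT

theorem integral_vertical_resolventSymbol_eq {α : ℝ} (hα : α ∈ Ioo (1 : ℝ) 2) {c d : ℝ}
    (hc : 0 < c) (hd : 0 < d) (u : ℝ) :
    ∫ y : ℝ, Complex.exp ((c + y * Complex.I) * u) * resolventSymbol α (c + y * Complex.I) =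
      ∫ y : ℝ, Complex.exp ((d + y * Complex.I) * u) * resolventSymbol α (d + y * Complex.I) := by
  let f : ℂ → ℂ := fun z => Complex.exp (z * u) * resolventSymbol α z
  have hf : DifferentiableOn ℂ f {z : ℂ | 0 < z.re} :=
    (by fun_prop : Differentiable ℂ fun z : ℂ => Complex.exp (z * u)).differentiableOn.mul
      (differentiableOn_resolventSymbol hα)
  have hrect : ∀ T : ℝ, (((∫ x : ℝ in c..d, f (x + (-T : ℝ) * Complex.I)) -
      ∫ x : ℝ in c..d, f (x + T * Complex.I)) +
      Complex.I • ∫ y : ℝ in (-T)..T, f (d + y * Complex.I)) -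
      Complex.I • ∫ y : ℝ in (-T)..T, f (c + y * Complex.I) = 0 := by
    intro T
    have := Complex.integral_boundary_rect_eq_zero_of_differentiableOn f
      (c + (-T : ℝ) * Complex.I) (d + T * Complex.I) (hf.mono ?_)
    · simpa using this
    · intro z hz
      have h1 := (Complex.mem_reProdIm.1 hz).1
      simp only [Complex.add_re, Complex.ofReal_re, Complex.mul_re, Complex.I_re, mul_zero,
        Complex.ofReal_im, Complex.I_im, mul_one, sub_self, add_zero] at h1
      exact (lt_min hc hd).trans_le h1.1
  have t1 := tendsto_integral_horizontal_resolventSymbol hα hc hd u (s := fun T => -T)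
    (fun T => abs_neg T)
  have t2 := tendsto_integral_horizontal_resolventSymbol hα hc hd u (s := fun T => T)
    (fun T => rfl)
  have t3 := intervalIntegral_tendsto_integral (integrable_cexp_mul_resolventSymbol hα hd u)
    Filter.tendsto_neg_atTop_atBot Filter.tendsto_id
  have t4 := intervalIntegral_tendsto_integral (integrable_cexp_mul_resolventSymbol hα hc u)
    Filter.tendsto_neg_atTop_atBot Filter.tendsto_id
  have t := ((t1.sub t2).add (t3.const_smul Complex.I)).sub (t4.const_smul Complex.I)
  have h0 := tendsto_nhds_unique (t.congr fun T => hrect T) tendsto_const_nhds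
  rw [sub_zero, zero_add, ← smul_sub, smul_eq_zero] at h0
  exact (sub_eq_zero.1 (h0.resolve_left Complex.I_ne_zero)).symm

theorem resolventSymbol_two_ne_zero {α : ℝ} (hα : α ∈ Ioo (1 : ℝ) 2) :
    resolventSymbol α 2 ≠ 0 := by
  have hα1 := hα.1
  have h2 : (1 : ℝ) ≤ 2 ^ α := Real.one_le_rpow (by norm_num) (by linarith)
  have h0 := one_add_cpow_ne_zero hα (z := 2) (by norm_num)
  have hN : ((α : ℂ) + 1) * 2 ^ (α : ℂ) - (α - 1) ≠ 0 := by
    have e : ((α : ℂ) + 1) * 2 ^ (α : ℂ) - (α - 1) =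
        (((α + 1) * 2 ^ α - (α - 1) : ℝ) : ℂ) := by
      push_cast [Complex.ofReal_cpow (show (0 : ℝ) ≤ 2 by norm_num)]
      rfl
    rw [e, Complex.ofReal_ne_zero]
    nlinarith
  have hz : (2 : ℂ) ^ ((α : ℂ) - 2) ≠ 0 := by simp [Complex.cpow_eq_zero_iff]
  have ha : (α : ℂ) ≠ 0 := Complex.ofReal_ne_zero.2 (by linarith)
  exact div_ne_zero (mul_ne_zero (mul_ne_zero ha hz) hN) (pow_ne_zero _ h0)

/-- The exponentially damped `resolventKernel α`, extended by zero to the negative axis. -/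
noncomputable def dampedKernel (α c : ℝ) : ℝ → ℂ :=
  (Ioi (0 : ℝ)).indicator fun u => Complex.exp (-(c * u)) * (resolventKernel α u : ℝ)

theorem continuous_dampedKernel {α : ℝ} (hα : 1 < α) (c : ℝ) :
    Continuous (dampedKernel α c) := by
  have := continuous_resolventKernel hα
  refine continuous_indicator (fun a ha => ?_) (Continuous.continuousOn (by fun_prop))
  rw [frontier_Ioi, mem_singleton_iff] at ha
  rw [ha, resolventKernel_zero hα, Complex.ofReal_zero, mul_zero]

theorem integral_cexp_mul_dampedKernel (α c : ℝ) (v : ℝ) :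
    ∫ u : ℝ, Complex.exp (((-2 * π * u * v : ℝ) : ℂ) * Complex.I) • dampedKernel α c u =
      ∫ u in Ioi (0 : ℝ), Complex.exp (-((c + (2 * π * v : ℝ) * Complex.I) * u)) *
        (resolventKernel α u : ℝ) := by
  rw [← integral_indicator measurableSet_Ioi]
  congr 1
  funext u
  by_cases hu : u ∈ Ioi (0 : ℝ)
  · rw [dampedKernel, indicator_of_mem hu, indicator_of_mem hu, smul_eq_mul, ← mul_assoc,
      ← Complex.exp_add]
    congr 2
    push_cast
    ring
  · rw [dampedKernel, indicator_of_notMem hu, indicator_of_notMem hu, smul_zero]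

theorem integrable_dampedKernel_two {α : ℝ} (hα : α ∈ Ioo (1 : ℝ) 2) :
    Integrable (dampedKernel α 2) := by
  rw [dampedKernel, integrable_indicator_iff measurableSet_Ioi]
  by_contra h
  refine resolventSymbol_two_ne_zero hα ?_
  have h1 := integral_cexp_mul_resolventKernel_of_one_lt_re hα.1 (z := ((2 : ℝ) : ℂ)) (by norm_num)
  rw [integral_undef h] at h1
  simpa using h1.symm

theorem integral_comp_two_pi_mul (g : ℝ → ℂ) :
    ∫ v : ℝ, g (2 * π * v) = (((2 * π)⁻¹ : ℝ) : ℂ) * ∫ y : ℝ, g y := by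
  rw [Measure.integral_comp_mul_left, abs_of_pos (by positivity), Complex.real_smul]

theorem fourierInv_resolventSymbol_vertical (α c u : ℝ) :
    FourierTransformInv.fourierInv
      (fun v : ℝ => resolventSymbol α (c + (2 * π * v : ℝ) * Complex.I)) u =
      Complex.exp (-(c * u)) * ((((2 * π)⁻¹ : ℝ) : ℂ) * ∫ y : ℝ,
        Complex.exp ((c + y * Complex.I) * u) * resolventSymbol α (c + y * Complex.I)) := by
  rw [Real.fourierInv_eq', ← integral_comp_two_pi_mul (fun y : ℝ =>
    Complex.exp ((c + y * Complex.I) * u) * resolventSymbol α (c + y * Complex.I)),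
    ← integral_const_mul]
  congr 1
  funext v
  rw [smul_eq_mul, ← mul_assoc, ← Complex.exp_add]
  congr 2
  simp
  ring

theorem dampedKernel_eq_fourierInv {α : ℝ} (hα : α ∈ Ioo (1 : ℝ) 2) {c : ℝ} (hc : 0 < c) :
    dampedKernel α c = FourierTransformInv.fourierInv
      (fun v : ℝ => resolventSymbol α (c + (2 * π * v : ℝ) * Complex.I)) := by
  have hF : FourierTransform.fourier (dampedKernel α 2) =
      fun v : ℝ => resolventSymbol α ((2 : ℝ) + (2 * π * v : ℝ) * Complex.I) := by
    funext v
    rw [Real.fourier_real_eq_integral_exp_smul, integral_cexp_mul_dampedKernel]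
    exact integral_cexp_mul_resolventKernel_of_one_lt_re hα.1 (by simp)
  have h2 := (continuous_dampedKernel hα.1 2).fourierInv_fourier_eq
    (integrable_dampedKernel_two hα) (by
      rw [hF]
      exact (integrable_resolventSymbol_vertical hα two_pos).comp_mul_left' (by positivity))
  rw [hF] at h2
  funext u
  have h3 := congrFun h2 u
  rw [fourierInv_resolventSymbol_vertical] at h3
  rw [fourierInv_resolventSymbol_vertical, integral_vertical_resolventSymbol_eq hα hc two_pos u]
  have h4 : Complex.exp (-(((2 : ℝ) : ℂ) * u)) ≠ 0 := Complex.exp_ne_zero _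
  by_cases hu : u ∈ Ioi (0 : ℝ)
  · rw [dampedKernel, indicator_of_mem hu] at h3 ⊢
    rw [mul_left_cancel₀ h4 h3]
  · rw [dampedKernel, indicator_of_notMem hu] at h3 ⊢
    rw [(mul_eq_zero.1 h3).resolve_left h4, mul_zero]

theorem exists_abs_resolventKernel_le_const {α : ℝ} (hα : α ∈ Ioo (1 : ℝ) 2) :
    ∃ B, ∀ u : ℝ, 0 < u → |resolventKernel α u| ≤ B := by
  obtain ⟨K, hK0, hK⟩ := exists_norm_resolventSymbol_le hα
  refine ⟨(2 * π)⁻¹ * (K * ∫ y, symbolMajorant α y), fun u hu => ?_⟩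
  have hB : ∀ c : ℝ, 0 < c → |resolventKernel α u| ≤
      rexp (c * u) * ((2 * π)⁻¹ * (K * ∫ y, symbolMajorant α y)) := by
    intro c hc
    have h := congrFun (dampedKernel_eq_fourierInv hα hc) u
    rw [fourierInv_resolventSymbol_vertical, dampedKernel, indicator_of_mem (mem_Ioi.2 hu)] at h
    have h := congrArg norm (mul_left_cancel₀ (Complex.exp_ne_zero _) h)
    rw [norm_mul, Complex.norm_real, Complex.norm_real, Real.norm_eq_abs,
      Real.norm_of_nonneg (by positivity)] at h
    rw [h, mul_left_comm]
    gcongr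
    rw [← integral_const_mul, ← integral_const_mul]
    refine norm_integral_le_of_norm_le
      (((integrable_symbolMajorant hα.1).const_mul K).const_mul _) ?_
    filter_upwards [compl_mem_ae_iff.2 (measure_singleton (0 : ℝ))] with y hy
    rw [norm_mul, norm_cexp_mul_ofReal]
    gcongr
    simpa using hK (c + y * Complex.I) (by simpa using hc) (by simpa using hy)
  have hlim : Filter.Tendsto
      (fun c : ℝ => rexp (c * u) * ((2 * π)⁻¹ * (K * ∫ y, symbolMajorant α y)))
      (nhdsWithin 0 (Ioi 0)) (nhds (rexp (0 * u) * ((2 * π)⁻¹ *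
        (K * ∫ y, symbolMajorant α y)))) :=
    ((by fun_prop : Continuous fun c : ℝ =>
      rexp (c * u) * ((2 * π)⁻¹ * (K * ∫ y, symbolMajorant α y))).tendsto 0).mono_left
        nhdsWithin_le_nhds
  rw [zero_mul, Real.exp_zero, one_mul] at hlim
  refine ge_of_tendsto hlim ?_
  filter_upwards [self_mem_nhdsWithin] with c hc using hB c hc

theorem integrable_dampedKernel {α : ℝ} (hα : α ∈ Ioo (1 : ℝ) 2) {c : ℝ} (hc : 0 < c) :
    Integrable (dampedKernel α c) := by
  obtain ⟨B, hB⟩ := exists_abs_resolventKernel_le_const hα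
  rw [dampedKernel, integrable_indicator_iff measurableSet_Ioi]
  have h := continuous_resolventKernel hα.1
  refine Integrable.mono' ((integrableOn_rpow_mul_exp_neg_mul one_pos hc).const_mul B)
    (by fun_prop : Continuous fun u : ℝ => Complex.exp (-(c * u)) *
      ((resolventKernel α u : ℝ) : ℂ)).aestronglyMeasurable ?_
  filter_upwards [ae_restrict_mem measurableSet_Ioi] with u hu
  rw [norm_mul, Complex.norm_exp, Complex.norm_real, Real.norm_eq_abs, sub_self, Real.rpow_zero,
    one_mul, mul_comm]
  simp only [Complex.neg_re, Complex.mul_re, Complex.ofReal_re, Complex.ofReal_im, mul_zero,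
    sub_zero]
  gcongr
  exact hB u hu

theorem integral_exp_mul_resolventKernel {α : ℝ} (hα : α ∈ Ioo (1 : ℝ) 2) {c : ℝ} (hc : 0 < c) :
    ∫ u in Ioi (0 : ℝ), resolventKernel α u * rexp (-(c * u)) =
      α * c ^ (α - 2) * ((α + 1) * c ^ α - (α - 1)) / (1 + c ^ α) ^ 3 := by
  let G : ℝ → ℂ := fun v => resolventSymbol α (c + (2 * π * v : ℝ) * Complex.I)
  have hG : Continuous G :=
    (continuous_resolventSymbol_vertical hα hc).comp (by fun_prop : Continuous fun v => 2 * π * v)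
  have hGi : Integrable G :=
    (integrable_resolventSymbol_vertical hα hc).comp_mul_left' (by positivity)
  have hinv : FourierTransformInv.fourierInv G = dampedKernel α c :=
    (dampedKernel_eq_fourierInv hα hc).symm
  have hGF : Integrable (FourierTransform.fourier G) := by
    have := (integrable_dampedKernel hα hc).comp_neg
    rw [← hinv] at this
    refine this.congr (Filter.Eventually.of_forall fun v => ?_)
    simp only
    rw [Real.fourierInv_eq_fourier_neg, neg_neg]
  have h := congrFun (hG.fourier_fourierInv_eq hGi hGF) 0
  rw [hinv, Real.fourier_real_eq_integral_exp_smul, integral_cexp_mul_dampedKernel] at h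
  simp only [G, mul_zero, Complex.ofReal_zero, zero_mul, add_zero] at h
  have h1 : ∫ u in Ioi (0 : ℝ), Complex.exp (-(c * u)) * (resolventKernel α u : ℝ) =
      ((∫ u in Ioi (0 : ℝ), resolventKernel α u * rexp (-(c * u)) : ℝ) : ℂ) := by
    rw [← integral_complex_ofReal]
    refine setIntegral_congr_fun measurableSet_Ioi fun u _ => ?_
    push_cast
    ring
  rw [h1] at h
  refine Complex.ofReal_injective (h.trans ?_)
  rw [resolventSymbol]
  push_cast [Complex.ofReal_cpow hc.le]
  rfl

theorem integral_rpow_mul_integral_mul_exp {h k : ℝ → ℝ} {a : ℝ} (ha : 0 < a)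
    (hh : Measurable h) (hk : Measurable k) (hk0 : ∀ u ∈ Ioi (0 : ℝ), 0 < k u)
    (hhk : IntegrableOn (fun u => h u * k u ^ (-a)) (Ioi 0)) :
    ∫ x in Ioi (0 : ℝ), x ^ (a - 1) * ∫ u in Ioi (0 : ℝ), h u * rexp (-(k u * x)) =
      Real.Gamma a * ∫ u in Ioi (0 : ℝ), h u * k u ^ (-a) := by
  have hΓ : ∀ u ∈ Ioi (0 : ℝ), ∫ x in Ioi (0 : ℝ), x ^ (a - 1) * rexp (-(k u * x)) =
      Real.Gamma a * k u ^ (-a) := fun u hu => by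
    rw [Real.integral_rpow_mul_exp_neg_mul_Ioi ha (hk0 u hu), one_div,
      Real.inv_rpow (hk0 u hu).le, ← Real.rpow_neg (hk0 u hu).le, mul_comm]
  have hmeas : Measurable (Function.uncurry fun x u : ℝ =>
      x ^ (a - 1) * (h u * rexp (-(k u * x)))) := by
    unfold Function.uncurry
    fun_prop
  have hintg : Integrable (Function.uncurry fun x u : ℝ =>
      x ^ (a - 1) * (h u * rexp (-(k u * x))))
      ((volume.restrict (Ioi 0)).prod (volume.restrict (Ioi 0))) := by
    rw [integrable_prod_iff' hmeas.aestronglyMeasurable]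
    refine ⟨?_, ?_⟩
    · filter_upwards [ae_restrict_mem measurableSet_Ioi] with u hu
      refine ((integrableOn_rpow_mul_exp_neg_mul ha (hk0 u hu)).const_mul (h u)).congr
        (Filter.Eventually.of_forall fun x => ?_)
      simp only [Function.uncurry]
      ring
    · refine (hhk.norm.const_mul (Real.Gamma a)).congr ?_
      filter_upwards [ae_restrict_mem measurableSet_Ioi] with u hu
      have e : ∫ x in Ioi (0 : ℝ), ‖Function.uncurry (fun x u : ℝ =>
          x ^ (a - 1) * (h u * rexp (-(k u * x)))) (x, u)‖ =
          ∫ x in Ioi (0 : ℝ), |h u| * (x ^ (a - 1) * rexp (-(k u * x))) := by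
        refine setIntegral_congr_fun measurableSet_Ioi fun x hx => ?_
        simp only [Function.uncurry, norm_mul, Real.norm_eq_abs, abs_exp,
          abs_of_pos (Real.rpow_pos_of_pos hx (a - 1))]
        ring
      rw [e, integral_const_mul, hΓ u hu, norm_mul, Real.norm_eq_abs,
        Real.norm_of_nonneg (Real.rpow_pos_of_pos (hk0 u hu) _).le]
      ring
  calc ∫ x in Ioi (0 : ℝ), x ^ (a - 1) * ∫ u in Ioi (0 : ℝ), h u * rexp (-(k u * x))
      = ∫ x in Ioi (0 : ℝ), ∫ u in Ioi (0 : ℝ), x ^ (a - 1) * (h u * rexp (-(k u * x))) := by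
        simp only [integral_const_mul]
    _ = ∫ u in Ioi (0 : ℝ), ∫ x in Ioi (0 : ℝ), x ^ (a - 1) * (h u * rexp (-(k u * x))) :=
        integral_integral_swap hintg
    _ = ∫ u in Ioi (0 : ℝ), Real.Gamma a * (h u * k u ^ (-a)) := by
        refine setIntegral_congr_fun measurableSet_Ioi fun u hu => ?_
        simp only [mul_left_comm _ (h u)]
        rw [integral_const_mul, hΓ u hu]
    _ = _ := integral_const_mul _ _

theorem integrableOn_Ioi_of_abs_le_rpow {f : ℝ → ℝ} {p q A B : ℝ} (hf : Measurable f)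
    (hp : -1 < p) (hq : q < -1) (hA : ∀ u ∈ Ioc (0 : ℝ) 1, |f u| ≤ A * u ^ p)
    (hB : ∀ u ∈ Ioi (1 : ℝ), |f u| ≤ B * u ^ q) : IntegrableOn f (Ioi 0) := by
  rw [← Ioc_union_Ioi_eq_Ioi (zero_le_one' ℝ)]
  refine IntegrableOn.union ?_ ?_
  · refine Integrable.mono' (((intervalIntegrable_iff_integrableOn_Ioc_of_le zero_le_one).1
      (intervalIntegral.intervalIntegrable_rpow' hp)).const_mul A) hf.aestronglyMeasurable ?_
    filter_upwards [ae_restrict_mem measurableSet_Ioc] with u hu using hA u hu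
  · refine Integrable.mono' ((integrableOn_Ioi_rpow_of_lt hq one_pos).const_mul B)
      hf.aestronglyMeasurable ?_
    filter_upwards [ae_restrict_mem measurableSet_Ioi] with u hu using hB u hu

theorem integrableOn_rpow_mul_resolventKernel {α q : ℝ} (hα : α ∈ Ioo (1 : ℝ) 2)
    (hq : -1 < q + (α + 1)) (hq' : q < -1) :
    IntegrableOn (fun u => u ^ q * resolventKernel α u) (Ioi 0) := by
  obtain ⟨A, hA⟩ := exists_abs_resolventKernel_le hα.1
  obtain ⟨B, hB⟩ := exists_abs_resolventKernel_le_const hα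
  have hm : Measurable (resolventKernel α) := (continuous_resolventKernel hα.1).measurable
  refine integrableOn_Ioi_of_abs_le_rpow (A := A) (B := B) (by fun_prop) hq hq' (fun u hu => ?_)
    fun u hu => ?_
  · rw [abs_mul, abs_of_pos (Real.rpow_pos_of_pos hu.1 q), Real.rpow_add hu.1, mul_left_comm]
    exact mul_le_mul_of_nonneg_left (hA u hu) (Real.rpow_pos_of_pos hu.1 q).le
  · have hu0 : 0 < u := zero_lt_one.trans hu
    rw [abs_mul, abs_of_pos (Real.rpow_pos_of_pos hu0 q), mul_comm]
    exact mul_le_mul_of_nonneg_right (hB u hu0) (Real.rpow_pos_of_pos hu0 q).le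

theorem integrableOn_rpow_mul_one_add_rpow {a b : ℝ} (hb : 0 < b) (hab : b < a) :
    IntegrableOn (fun u : ℝ => u ^ (b - 1) * (1 + u) ^ (-a)) (Ioi 0) := by
  refine integrableOn_Ioi_of_abs_le_rpow (p := b - 1) (q := b - 1 - a) (A := 1) (B := 1)
    (by fun_prop) (by linarith) (by linarith) (fun u hu => ?_) fun u hu => ?_
  · have h1 : (1 + u) ^ (-a) ≤ 1 :=
      Real.rpow_le_one_of_one_le_of_nonpos (by linarith [hu.1]) (by linarith)
    have h0 := Real.rpow_pos_of_pos hu.1 (b - 1)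
    have h2 : 0 < (1 + u) ^ (-a) := Real.rpow_pos_of_pos (by linarith [hu.1]) _
    rw [abs_of_pos (by positivity), one_mul]
    exact mul_le_of_le_one_right h0.le h1
  · have hu0 : 0 < u := zero_lt_one.trans hu
    have h1 : (1 + u) ^ (-a) ≤ u ^ (-a) :=
      Real.rpow_le_rpow_of_nonpos hu0 (by linarith) (by linarith)
    have h0 := Real.rpow_pos_of_pos hu0 (b - 1)
    have h2 : 0 < (1 + u) ^ (-a) := Real.rpow_pos_of_pos (by linarith) _
    rw [abs_of_pos (by positivity), one_mul, sub_eq_add_neg (b - 1), Real.rpow_add hu0]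
    exact mul_le_mul_of_nonneg_left h1 h0.le

theorem integral_rpow_mul_one_add_rpow {a b : ℝ} (hb : 0 < b) (hab : b < a) :
    ∫ u in Ioi (0 : ℝ), u ^ (b - 1) * (1 + u) ^ (-a) =
      Real.Gamma b * Real.Gamma (a - b) / Real.Gamma a := by
  have ha : 0 < a := hb.trans hab
  rw [eq_div_iff (Real.Gamma_pos_of_pos ha).ne', mul_comm,
    ← integral_rpow_mul_integral_mul_exp (k := fun u => 1 + u) ha (by fun_prop) (by fun_prop)
      (fun u hu => by have := mem_Ioi.1 hu; linarith) (integrableOn_rpow_mul_one_add_rpow hb hab),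
    mul_comm (Real.Gamma b)]
  have h1 := Real.integral_rpow_mul_exp_neg_mul_Ioi (sub_pos.2 hab) one_pos
  rw [div_one, Real.one_rpow, one_mul] at h1
  rw [← h1, ← integral_mul_const]
  refine setIntegral_congr_fun measurableSet_Ioi fun x hx => ?_
  have hx : 0 < x := hx
  have e : ∫ u in Ioi (0 : ℝ), u ^ (b - 1) * rexp (-((1 + u) * x)) =
      rexp (-(1 * x)) * ∫ u in Ioi (0 : ℝ), u ^ (b - 1) * rexp (-(x * u)) := by
    rw [← integral_const_mul]
    refine setIntegral_congr_fun measurableSet_Ioi fun u _ => ?_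
    rw [mul_left_comm, ← Real.exp_add]
    ring_nf
  rw [e, Real.integral_rpow_mul_exp_neg_mul_Ioi hb hx, one_div, Real.inv_rpow hx.le,
    ← Real.rpow_neg hx.le]
  have : x ^ (a - b - 1) = x ^ (a - 1) * x ^ (-b) := by
    rw [← Real.rpow_add hx]; congr 1; ring
  rw [this]
  ring

theorem integral_rpow_mul_resolventKernel {α w : ℝ} (hα : α ∈ Ioo (1 : ℝ) 2) (hw : -1 < w)
    (hwα : w < α) (hνw : -1 < w / α) :
    ∫ u in Ioi (0 : ℝ), u ^ (-(w + 2)) * resolventKernel α u =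
      (w + 1) * (Real.Gamma (1 + w / α) * Real.Gamma (1 - w / α)) / Real.Gamma (w + 2) := by
  have hα0 : 0 < α := by linarith [hα.1]
  have hν1 : w / α < 1 := (div_lt_one hα0).2 hwα
  set ν := w / α with hν
  have hwν : w = α * ν := by rw [hν]; field_simp
  have hP : Measurable (resolventKernel α) := (continuous_resolventKernel hα.1).measurable
  rw [eq_div_iff (Real.Gamma_pos_of_pos (by linarith)).ne', mul_comm]
  have h1 := integral_rpow_mul_integral_mul_exp (h := resolventKernel α) (k := fun u => u)
    (a := w + 2) (by linarith) hP measurable_id (fun u hu => hu) (by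
      simpa only [mul_comm] using
        integrableOn_rpow_mul_resolventKernel (q := -(w + 2)) hα (by linarith) (by linarith))
  simp_rw [mul_comm _ (resolventKernel α _)]
  rw [← h1]
  let g : ℝ → ℝ := fun v => v ^ ν * ((α + 1) * v - (α - 1)) / (1 + v) ^ 3
  have e1 : ∫ x in Ioi (0 : ℝ), x ^ (w + 2 - 1) *
      ∫ u in Ioi (0 : ℝ), resolventKernel α u * rexp (-(u * x)) =
      ∫ x in Ioi (0 : ℝ), (α * x ^ (α - 1)) • g (x ^ α) := by
    refine setIntegral_congr_fun measurableSet_Ioi fun x hx => ?_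
    have hx : 0 < x := hx
    simp only [mul_comm _ x, g, smul_eq_mul]
    rw [integral_exp_mul_resolventKernel hα hx]
    have e : x ^ (w + 2 - 1) * x ^ (α - 2) = x ^ (α - 1) * (x ^ α) ^ ν := by
      rw [← Real.rpow_mul hx.le, ← hwν, ← Real.rpow_add hx, ← Real.rpow_add hx]
      ring_nf
    calc _ = α * (x ^ (w + 2 - 1) * x ^ (α - 2)) * ((α + 1) * x ^ α - (α - 1)) /
          (1 + x ^ α) ^ 3 := by ring
      _ = _ := by rw [e]; ring
  have i1 := integrableOn_rpow_mul_one_add_rpow (a := 3) (b := ν + 2) (by linarith) (by linarith)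
  have i2 := integrableOn_rpow_mul_one_add_rpow (a := 3) (b := ν + 1) (by linarith) (by linarith)
  have b1 := integral_rpow_mul_one_add_rpow (a := 3) (b := ν + 2) (by linarith) (by linarith)
  have b2 := integral_rpow_mul_one_add_rpow (a := 3) (b := ν + 1) (by linarith) (by linarith)
  have e2 : ∫ v in Ioi (0 : ℝ), g v = (α + 1) * (∫ v in Ioi (0 : ℝ),
      v ^ (ν + 2 - 1) * (1 + v) ^ (-3 : ℝ)) - (α - 1) * ∫ v in Ioi (0 : ℝ),
      v ^ (ν + 1 - 1) * (1 + v) ^ (-3 : ℝ) := by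
    rw [← integral_const_mul, ← integral_const_mul,
      ← integral_sub (i1.const_mul (α + 1)) (i2.const_mul (α - 1))]
    refine setIntegral_congr_fun measurableSet_Ioi fun v hv => ?_
    have hv : 0 < v := hv
    have e3 : (1 + v) ^ (-3 : ℝ) = ((1 + v) ^ 3)⁻¹ := by
      rw [Real.rpow_neg (by linarith)]
      norm_cast
    have e4 : v ^ (ν + 2 - 1) = v ^ ν * v := by
      rw [← Real.rpow_add_one hv.ne']
      ring_nf
    simp only [g, e3, e4, add_sub_cancel_right]
    ring
  rw [e1, integral_comp_rpow_Ioi_of_pos hα0, e2, b1, b2]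
  have g1 : Real.Gamma (ν + 2) = (ν + 1) * Real.Gamma (1 + ν) := by
    rw [show ν + 2 = (ν + 1) + 1 by ring, Real.Gamma_add_one (by linarith), add_comm 1 ν]
  have g2 : Real.Gamma (3 - (ν + 1)) = (1 - ν) * Real.Gamma (1 - ν) := by
    rw [show 3 - (ν + 1) = (1 - ν) + 1 by ring, Real.Gamma_add_one (by linarith)]
  have g3 : Real.Gamma 3 = 2 := by
    rw [show (3 : ℝ) = 2 + 1 by norm_num, Real.Gamma_add_one two_ne_zero, Real.Gamma_two, mul_one]
  rw [g1, g2, g3, show 3 - (ν + 2) = 1 - ν by ring, add_comm ν 1, hwν]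
  ring

theorem exitDensity_term_eq {α : ℝ} (hα : 1 < α) (x : ℝ) (n : ℕ) :
    x ^ (1 / α - ((n : ℝ) + 1) - 1) / (α * Real.Gamma (α * ((n : ℝ) + 1) - 1) *
      Real.Gamma (1 + 1 / α - ((n : ℝ) + 1))) =
    Real.sin (π / α) / π * ((-1) ^ n * (Real.Gamma ((n : ℝ) + 2 - 1 / α) /
      Real.Gamma (α * ((n : ℝ) + 1)) * x ^ (-((n : ℝ) + 2 - 1 / α)))) := by
  have hα0 : 0 < α := by linarith
  have hb : 1 / α < 1 := by rw [div_lt_one hα0]; exact hα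
  have hb0 : 0 < 1 / α := by positivity
  have hn : (0 : ℝ) ≤ n := n.cast_nonneg
  have hy : 0 < (n : ℝ) + 1 - 1 / α := by linarith
  have hαy : 0 < α * ((n : ℝ) + 1) - 1 := by nlinarith
  have g1 : Real.Gamma ((n : ℝ) + 2 - 1 / α) =
      ((n : ℝ) + 1 - 1 / α) * Real.Gamma ((n : ℝ) + 1 - 1 / α) := by
    rw [← Real.Gamma_add_one hy.ne']; ring_nf
  have g2 : Real.Gamma (α * ((n : ℝ) + 1)) =
      (α * ((n : ℝ) + 1) - 1) * Real.Gamma (α * ((n : ℝ) + 1) - 1) := by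
    rw [← Real.Gamma_add_one hαy.ne']; ring_nf
  have hs : Real.sin (π * ((n : ℝ) + 1 - 1 / α)) = (-1) ^ n * Real.sin (π / α) := by
    have : π * ((n : ℝ) + 1 - 1 / α) = (π - π / α) + n * π := by ring
    rw [this, Real.sin_add_nat_mul_pi, Real.sin_pi_sub]
  have hr := Real.Gamma_mul_Gamma_one_sub ((n : ℝ) + 1 - 1 / α)
  rw [hs, show 1 - ((n : ℝ) + 1 - 1 / α) = 1 + 1 / α - ((n : ℝ) + 1) by ring] at hr
  have hG := Real.Gamma_pos_of_pos hy
  have hG' := Real.Gamma_pos_of_pos hαy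
  have hm0 : (-1 : ℝ) ^ n ≠ 0 := pow_ne_zero _ (by norm_num)
  have hR : Real.Gamma (1 + 1 / α - ((n : ℝ) + 1)) =
      π / ((-1) ^ n * Real.sin (π / α)) / Real.Gamma ((n : ℝ) + 1 - 1 / α) := by
    rw [← hr]; field_simp
  have hαα : α * ((n : ℝ) + 1) - 1 = α * ((n : ℝ) + 1 - 1 / α) := by field_simp
  rw [hR, g1, g2, show 1 / α - ((n : ℝ) + 1) - 1 = -((n : ℝ) + 2 - 1 / α) by ring]
  nth_rewrite 2 [hαα]
  have := Real.pi_pos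
  generalize Real.Gamma ((n : ℝ) + 1 - 1 / α) = G at *
  generalize Real.Gamma (α * ((n : ℝ) + 1) - 1) = G' at *
  generalize x ^ (-((n : ℝ) + 2 - 1 / α)) = X
  generalize (n : ℝ) + 1 - 1 / α = y at *
  field_simp

theorem rpow_neg_nat_add {x b : ℝ} (hx : 0 < x) (n : ℕ) :
    x ^ (-((n : ℝ) + b)) = x ^ (-b) * (1 / x) ^ n := by
  rw [one_div, inv_pow, ← Real.rpow_natCast, ← Real.rpow_neg hx.le, ← Real.rpow_add hx]
  ring_nf

theorem summable_Gamma_div_Gamma_mul_rpow {α x : ℝ} (hα : 1 < α) (hx : 0 < x) :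
    Summable fun n : ℕ => Real.Gamma ((n : ℝ) + 2 - 1 / α) / Real.Gamma (α * ((n : ℝ) + 1)) *
      x ^ (-((n : ℝ) + 2 - 1 / α)) := by
  refine ((summable_pow_mul_Gamma_div_Gamma hα (one_div_pos.2 hx)).mul_left
    (x ^ (-(2 - 1 / α)))).congr fun n => ?_
  rw [show (n : ℝ) + 2 - 1 / α = n + (2 - 1 / α) by ring, rpow_neg_nat_add hx]
  ring

theorem summable_abs_exitDensity_term {α x : ℝ} (hα : 1 < α) (hx : 0 < x) :
    Summable fun n : ℕ => |x ^ (1 / α - ((n : ℝ) + 1) - 1) /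
      (α * Real.Gamma (α * ((n : ℝ) + 1) - 1) * Real.Gamma (1 + 1 / α - ((n : ℝ) + 1)))| := by
  refine ((summable_Gamma_div_Gamma_mul_rpow hα hx).abs.mul_left
    |Real.sin (π / α) / π|).congr fun n => ?_
  rw [exitDensity_term_eq hα x, abs_mul (Real.sin (π / α) / π), abs_mul ((-1) ^ n),
    abs_neg_one_pow, one_mul]

theorem exitDensity_eq_integral {α x : ℝ} (hα : 1 < α) (hx : 0 < x) :
    exitDensity α x = Real.sin (π / α) / π * (α * ∫ u in Ioi (0 : ℝ),
      u ^ (α - 3) * resolventKernel α u * rexp (-(u ^ α * x))) := by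
  have hα0 : 0 < α := by linarith
  have hb : 1 / α < 1 := by rw [div_lt_one hα0]; exact hα
  let q : ℕ → ℝ := fun n => α * ((n : ℝ) + 1) + α - 2
  have hq : ∀ n, -1 < q n := fun n => by
    have : 0 ≤ α * n := by positivity
    simp only [q]; linarith
  let f : ℕ → ℝ → ℝ := fun n u => (-1) ^ n / Real.Gamma (α * ((n : ℝ) + 1)) *
    (u ^ q n * rexp (-x * u ^ α))
  have hΓ : ∀ n : ℕ, 0 < Real.Gamma (α * ((n : ℝ) + 1)) :=
    fun n => Real.Gamma_pos_of_pos (by positivity)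
  have hI : ∀ n, ∫ u in Ioi (0 : ℝ), u ^ q n * rexp (-x * u ^ α) =
      1 / α * (Real.Gamma ((n : ℝ) + 2 - 1 / α) * x ^ (-((n : ℝ) + 2 - 1 / α))) := fun n => by
    rw [integral_rpow_mul_exp_neg_mul_rpow hα0 (hq n) hx]
    have e : (q n + 1) / α = (n : ℝ) + 2 - 1 / α := by simp only [q]; field_simp; ring
    rw [neg_div, e]
    ring
  have hf : ∀ n, Integrable (f n) (volume.restrict (Ioi 0)) := fun n =>
    (integrableOn_rpow_mul_exp_neg_mul_rpow (hq n) hα0 hx).const_mul _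
  have hn : ∀ n, ∫ u in Ioi (0 : ℝ), ‖f n u‖ = 1 / α * (Real.Gamma ((n : ℝ) + 2 - 1 / α) /
      Real.Gamma (α * ((n : ℝ) + 1)) * x ^ (-((n : ℝ) + 2 - 1 / α))) := fun n => by
    have : ∫ u in Ioi (0 : ℝ), ‖f n u‖ = ∫ u in Ioi (0 : ℝ),
        1 / Real.Gamma (α * ((n : ℝ) + 1)) * (u ^ q n * rexp (-x * u ^ α)) := by
      refine setIntegral_congr_fun measurableSet_Ioi fun u hu => ?_
      have h1 : 0 < u ^ q n := Real.rpow_pos_of_pos hu _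
      simp only [f, norm_mul, norm_div, norm_pow, norm_neg, norm_one, one_pow, Real.norm_eq_abs,
        abs_exp, abs_of_pos h1, abs_of_pos (hΓ n)]
    rw [this, integral_const_mul, hI]
    ring
  have h := hasSum_integral_of_summable_integral_norm hf (by
    simp only [hn]
    exact (summable_Gamma_div_Gamma_mul_rpow hα hx).mul_left _)
  have e : ∫ u in Ioi (0 : ℝ), u ^ (α - 3) * resolventKernel α u * rexp (-(u ^ α * x)) =
      ∫ u in Ioi (0 : ℝ), ∑' n, f n u := by
    refine setIntegral_congr_fun measurableSet_Ioi fun u hu => ?_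
    have hu : 0 < u := hu
    rw [resolventKernel_eq_tsum hu, ← tsum_mul_left, ← tsum_mul_right]
    refine tsum_congr fun n => ?_
    have : u ^ q n = u ^ (α - 3) * u ^ (α * ((n : ℝ) + 1) + 1) := by
      rw [← Real.rpow_add hu]; simp only [q]; ring_nf
    simp only [f]
    rw [this, show -(u ^ α * x) = -x * u ^ α by ring]
    ring
  rw [e, ← h.tsum_eq, exitDensity, ← tsum_mul_left, ← tsum_mul_left]
  refine tsum_congr fun n => ?_
  rw [exitDensity_term_eq hα x]
  simp only [f]
  rw [integral_const_mul, hI]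
  field_simp

theorem integral_rpow_mul_exitDensity {α s : ℝ} (hα : α ∈ Ioo (1 : ℝ) 2) (hs : -1 < s)
    (hs1 : s < 1 - 1 / α) (hs0 : s ≠ -(1 / α)) :
    ∫ x in Ioi (0 : ℝ), x ^ s * exitDensity α x =
      Real.Gamma (1 + s) * Real.sin (π / α) /
        (Real.Gamma (1 + s * α) * Real.sin (π * (s + 1 / α))) := by
  have hα1 := hα.1
  have hα2 := hα.2
  have hα0 : 0 < α := by linarith
  have hwα : (1 + s * α) / α = s + 1 / α := by field_simp; ring
  have hb0 : 0 < 1 / α := by positivity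
  have hw1 : -1 < 1 + s * α := by nlinarith
  have hw2 : 1 + s * α < α := by
    have := (div_lt_one hα0).1 (show (1 + s * α) / α < 1 by rw [hwα]; linarith)
    exact this
  have hw0 : 1 + s * α ≠ 0 := fun h => hs0 (by
    rw [h, zero_div] at hwα; linarith)
  have hP : Measurable (resolventKernel α) := (continuous_resolventKernel hα1).measurable
  have hk : ∀ u ∈ Ioi (0 : ℝ), u ^ (α - 3) * resolventKernel α u * (u ^ α) ^ (-(1 + s)) =
      u ^ (-(1 + s * α + 2)) * resolventKernel α u := fun u hu => by
    have hu : 0 < u := hu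
    rw [← Real.rpow_mul hu.le, mul_right_comm, ← Real.rpow_add hu]
    ring_nf
  have h1 := integral_rpow_mul_integral_mul_exp
    (h := fun u => u ^ (α - 3) * resolventKernel α u) (k := fun u => u ^ α) (a := 1 + s)
    (by linarith) (by fun_prop) (by fun_prop) (fun u hu => Real.rpow_pos_of_pos hu α)
    ((integrableOn_rpow_mul_resolventKernel hα (by linarith) (by linarith)).congr_fun
      (fun u hu => (hk u hu).symm) measurableSet_Ioi)
  rw [setIntegral_congr_fun measurableSet_Ioi hk,
    integral_rpow_mul_resolventKernel hα hw1 hw2 (by rw [hwα]; linarith), hwα,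
    add_sub_cancel_left] at h1
  have e : ∫ x in Ioi (0 : ℝ), x ^ s * exitDensity α x =
      Real.sin (π / α) / π * α * ∫ x in Ioi (0 : ℝ), x ^ s * ∫ u in Ioi (0 : ℝ),
        u ^ (α - 3) * resolventKernel α u * rexp (-(u ^ α * x)) := by
    rw [← integral_const_mul]
    refine setIntegral_congr_fun measurableSet_Ioi fun x hx => ?_
    rw [exitDensity_eq_integral hα1 hx]
    ring
  rw [e, h1]
  have hν0 : s + 1 / α ≠ 0 := fun h => hs0 (by linarith)
  have hr := Real.Gamma_mul_Gamma_one_sub (s + 1 / α)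
  have hA : Real.Gamma (1 + (s + 1 / α)) * Real.Gamma (1 - (s + 1 / α)) =
      (s + 1 / α) * (π / Real.sin (π * (s + 1 / α))) := by
    rw [add_comm 1, Real.Gamma_add_one hν0, mul_assoc, hr]
  have hG : Real.Gamma (1 + s * α + 2) = (1 + s * α + 1) * ((1 + s * α) *
      Real.Gamma (1 + s * α)) := by
    rw [← Real.Gamma_add_one hw0, ← Real.Gamma_add_one (by linarith)]
    ring_nf
  have hw3 : 1 + s * α + 1 ≠ 0 := by linarith
  have hπ := Real.pi_ne_zero
  rw [hA, hG]
  generalize Real.sin (π * (s + 1 / α)) = S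
  rw [← hwα]
  generalize 1 + s * α = w at *
  field_simp

/-- For every `α ∈ (1,2)`, the series defining `g_α(x)` converges
absolutely for every `x > 0`, and for every real `s` with `−1 < s < 1 − 1/α`,
`s ≠ −1/α`, one has
`∫₀^∞ x^s g_α(x) dx = Γ(1+s) sin(π/α) / (Γ(1+sα) sin(π(s+1/α)))`;
in particular (taking `s = 0`) `∫₀^∞ g_α(x) dx = 1`. -/
theorem stmt_12 (α : ℝ) (hα : α ∈ Set.Ioo (1 : ℝ) 2) :
    (∀ x : ℝ, 0 < x →
      Summable (fun n : ℕ => |x ^ (1 / α - ((n : ℝ) + 1) - 1) /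
        (α * Real.Gamma (α * ((n : ℝ) + 1) - 1) * Real.Gamma (1 + 1 / α - ((n : ℝ) + 1)))|)) ∧
    (∀ s : ℝ, -1 < s → s < 1 - 1 / α → s ≠ -(1 / α) →
      ∫ x in Set.Ioi (0 : ℝ), x ^ s * exitDensity α x
        = Real.Gamma (1 + s) * Real.sin (π / α) /
            (Real.Gamma (1 + s * α) * Real.sin (π * (s + 1 / α)))) ∧
    ∫ x in Set.Ioi (0 : ℝ), exitDensity α x = 1 := by
  refine ⟨fun x hx => summable_abs_exitDensity_term hα.1 hx,
    fun s hs hs1 hs0 => integral_rpow_mul_exitDensity hα hs hs1 hs0, ?_⟩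
  have hα1 := hα.1
  have hα0 : 0 < α := by linarith
  have hb0 : 0 < 1 / α := by positivity
  have hb : 1 / α < 1 := by rw [div_lt_one hα0]; exact hα1
  have hsin : 0 < Real.sin (π / α) := by
    refine Real.sin_pos_of_pos_of_lt_pi (by positivity) ?_
    rw [div_lt_iff₀ hα0]
    nlinarith [Real.pi_pos]
  have h := integral_rpow_mul_exitDensity hα (s := 0) (by norm_num) (by linarith)
    (by linarith [neg_neg_of_pos hb0] : (0 : ℝ) > -(1 / α)).ne'
  simpa [← div_eq_mul_inv, hsin.ne'] using h
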